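/- For every integer k ≥ 2, the subsequence (v_{kn})_{n≥0} of the word vtm is not squarefree: there exist n ≥ 0 and L ≥ 1 such that v_{k(n+j)} = v_{k(n+L+j)} for all 0 ≤ j < L. -/

import Mathlib

/-- The morphism μ : 0 ↦ 012, 1 ↦ 02, 2 ↦ 1. -/
def mu : Fin 3 → List (Fin 3)
  | 0 => [0, 1, 2]
  | 1 => [0, 2]
  | 2 => [1]

/-- Apply μ to a finite word. -/
def muWord (l : List (Fin 3)) : List (Fin 3) := l.flatMap mu

/-- The word vtm = 012021012102012⋯, the fixed point of μ starting with 0,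
obtained as the limit of μ^n(0): since μ^m(0) is a prefix of μ^(m+1)(0) and
its length exceeds n for m = n+1, the n-th letter is read off from μ^(n+1)(0). -/
def vtm (n : ℕ) : Fin 3 := ((muWord^[n + 1]) [0]).getD n 0

/-- The Thue–Morse sequence. -/
def tm (n : ℕ) : Bool :=
  if h : n = 0 then false else xor (decide (n % 2 = 1)) (tm (n / 2))
termination_by n
decreasing_by omega

theorem tm_zero : tm 0 = false := by rw [tm]; simp

theorem tm_even (n : ℕ) : tm (2 * n) = tm n := by
  rcases Nat.eq_zero_or_pos n with h | h
  · subst h; rfl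
  · rw [tm]
    have h1 : 2 * n ≠ 0 := by omega
    have h2 : 2 * n / 2 = n := by omega
    simp [h2]
    intro _; omega

theorem tm_odd (n : ℕ) : tm (2 * n + 1) = !tm n := by
  rw [tm]
  have h2 : (2 * n + 1) / 2 = n := by omega
  have h3 : (2 * n + 1) % 2 = 1 := by omega
  simp [h2, h3]

theorem tm_one : tm 1 = true := by
  have := tm_odd 0
  simpa [tm_zero] using this

theorem tm_two : tm 2 = true := by
  have := tm_even 1
  simpa [tm_one] using this

/-- Difference coding. -/
def fcode : Bool → Bool → Fin 3
  | false, true => 0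
  | true, false => 2
  | true, true => 1
  | false, false => 1

def gseq (n : ℕ) : Fin 3 := fcode (tm n) (tm (n + 1))

def pre (n : ℕ) : List (Fin 3) := (List.range n).map gseq

theorem pre_succ (n : ℕ) : pre (n + 1) = pre n ++ [gseq n] := by
  simp [pre, List.range_succ]

theorem g_even (n : ℕ) : gseq (2 * n) = fcode (tm n) (!tm n) := by
  rw [gseq, tm_even, tm_odd]

theorem g_odd (n : ℕ) : gseq (2 * n + 1) = fcode (!tm n) (tm (n + 1)) := by
  rw [gseq, tm_odd, show 2 * n + 1 + 1 = 2 * (n + 1) by ring, tm_even]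

theorem mu_pre (n : ℕ) : muWord (pre n) = pre (2 * n + (tm n).toNat) := by
  induction n with
  | zero => simp [pre, muWord, tm_zero]
  | succ n ih =>
    have h : muWord (pre (n + 1)) = muWord (pre n) ++ mu (gseq n) := by
      simp [pre_succ, muWord]
    rw [h, ih, show 2 * (n + 1) = 2 * n + 1 + 1 by ring]
    have e0 := g_even n
    have e1 := g_odd n
    have e2 := g_even (n + 1)
    rw [show 2 * (n + 1) = 2 * n + 1 + 1 by ring] at e2
    rw [gseq]
    cases ha : tm n <;> cases hb : tm (n + 1) <;>
      simp [ha, hb, fcode] at e0 e1 e2 ⊢ <;>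
      simp [pre_succ, e0, e1, e2, mu]

theorem iter_pre (m : ℕ) : ∃ l, m + 1 ≤ l ∧ muWord^[m] [0] = pre l := by
  induction m with
  | zero => exact ⟨1, le_refl _, by simp [pre, gseq, tm_zero, tm_one, fcode]⟩
  | succ m ih =>
    obtain ⟨l, hl, h⟩ := ih
    refine ⟨2 * l + (tm l).toNat, by omega, ?_⟩
    rw [Function.iterate_succ_apply', h, mu_pre]

theorem vtm_eq (n : ℕ) : vtm n = gseq n := by
  obtain ⟨l, hl, h⟩ := iter_pre (n + 1)
  have : n < l := by omega
  simp [vtm, h, pre, List.getD, this]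

theorem tm_add (r : ℕ) : ∀ x y : ℕ, y < 2 ^ r → tm (2 ^ r * x + y) = xor (tm x) (tm y) := by
  induction r with
  | zero => intro x y hy; have : y = 0 := by simpa using hy
            subst this; simp [tm_zero]
  | succ r ih =>
    intro x y hy
    rw [pow_succ] at hy
    have := ih x (y / 2) (by omega)
    obtain ⟨z, rfl | rfl⟩ := Nat.even_or_odd' y
    · rw [show 2 * z / 2 = z by omega] at this
      rw [show 2 ^ (r + 1) * x + 2 * z = 2 * (2 ^ r * x + z) by ring, tm_even, tm_even, this]
    · rw [show (2 * z + 1) / 2 = z by omega] at this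
      rw [show 2 ^ (r + 1) * x + (2 * z + 1) = 2 * (2 ^ r * x + z) + 1 by ring, tm_odd, tm_odd, this]
      simp

theorem exists_diff (d : ℕ) (hd : 1 ≤ d) (e : Bool) :
    ∃ z, xor (tm z) (tm (z + d)) = e ∧ (Odd d → Odd z) := by
  have hlt : d < 2 ^ d := Nat.lt_two_pow_self
  have hodd : Odd d → Odd (2 ^ d - d) := by
    intro h
    refine Nat.Even.sub_odd hlt.le ?_ h
    exact (Nat.even_pow.2 ⟨even_two, by omega⟩)
  have key : ∀ x, xor (tm (2 ^ d * x + (2 ^ d - d))) (tm (2 ^ d * x + (2 ^ d - d) + d))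
      = xor (xor (tm x) (tm (2 ^ d - d))) (tm (x + 1)) := by
    intro x
    rw [tm_add d x _ (by omega)]
    have : 2 ^ d * x + (2 ^ d - d) + d = 2 ^ d * (x + 1) + 0 := by
      rw [mul_add]; omega
    rw [this, tm_add d _ 0 (by positivity), tm_zero]
    simp
  have ho : ∀ x, Odd d → Odd (2 ^ d * x + (2 ^ d - d)) := by
    intro x h
    refine Even.add_odd ?_ (hodd h)
    exact Even.mul_right (Nat.even_pow.2 ⟨even_two, by omega⟩) _
  have k0 := key 0
  have k1 := key 1
  simp only [zero_add, tm_zero, tm_one, one_add_one_eq_two, tm_two] at k0 k1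
  by_cases he : e = tm (2 ^ d - d)
  · refine ⟨_, k1.trans ?_, ho 1⟩
    rw [he]; cases tm (2 ^ d - d) <;> rfl
  · refine ⟨_, k0.trans ?_, ho 0⟩
    cases e <;> cases h : tm (2 ^ d - d) <;> simp_all

theorem exists_odd_diff (d : ℕ) (hd : 1 ≤ d) (e : Bool) :
    ∃ z, xor (tm z) (tm (z + d)) = e ∧ Odd z := by
  obtain ⟨p, rfl | hp⟩ := Nat.even_or_odd' d
  · obtain ⟨z, hz, -⟩ := exists_diff p (by omega) e
    refine ⟨2 * z + 1, ?_, ⟨z, rfl⟩⟩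
    rw [show 2 * z + 1 + 2 * p = 2 * (z + p) + 1 by ring, tm_odd, tm_odd, ← hz]
    simp
  · obtain ⟨z, hz, ho⟩ := exists_diff d hd e
    exact ⟨z, hz, ho ⟨p, hp⟩⟩

theorem exists_y (k : ℕ) (hk : 2 ≤ k) (ho : Odd k) :
    ∃ z, Odd z ∧ tm (4 * z) = tm (4 * z + k) := by
  have h4 : ∀ z, tm (4 * z) = tm z := fun z => by
    rw [show 4 * z = 2 * (2 * z) by ring, tm_even, tm_even]
  have h41 : ∀ z, tm (4 * z + 1) = !tm z := fun z => by
    rw [show 4 * z + 1 = 2 * (2 * z) + 1 by ring, tm_odd, tm_even]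
  have h43 : ∀ z, tm (4 * z + 3) = tm z := fun z => by
    rw [show 4 * z + 3 = 2 * (2 * z + 1) + 1 by ring, tm_odd, tm_odd]; simp
  obtain ⟨p, rfl⟩ := ho
  obtain ⟨q, rfl | rfl⟩ := Nat.even_or_odd' p
  · obtain ⟨z, hz, hzo⟩ := exists_odd_diff q (by omega) true
    refine ⟨z, hzo, ?_⟩
    rw [show 4 * z + (2 * (2 * q) + 1) = 4 * (z + q) + 1 by ring, h4, h41]
    revert hz; cases tm z <;> cases tm (z + q) <;> simp
  · rcases Nat.eq_zero_or_pos q with rfl | hq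
    · exact ⟨1, odd_one, by rw [h4]; exact (h43 1).symm⟩
    obtain ⟨z, hz, hzo⟩ := exists_odd_diff q hq false
    refine ⟨z, hzo, ?_⟩
    rw [show 4 * z + (2 * (2 * q + 1) + 1) = 4 * (z + q) + 3 by ring, h4, h43]
    revert hz; cases tm z <;> cases tm (z + q) <;> simp

/-- If `n + 1` is odd or `4 * odd`, the letter at `n` is determined by `tm (n + 1)`. -/
theorem g_of_odd (n : ℕ) (h : Odd (n + 1)) :
    gseq n = fcode (!tm (n + 1)) (tm (n + 1)) := by
  obtain ⟨m, hm⟩ := h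
  obtain rfl : n = 2 * m := by omega
  rw [gseq, tm_odd, tm_even]; simp

theorem g_of_four (n z : ℕ) (hz : Odd z) (h : n + 1 = 4 * z) :
    gseq n = fcode (!tm (n + 1)) (tm (n + 1)) := by
  obtain ⟨m, rfl⟩ := hz
  obtain rfl : n = 2 * (2 * (2 * m) + 1) + 1 := by omega
  rw [gseq, h, tm_odd, tm_odd, tm_even,
    show 4 * (2 * m + 1) = 2 * (2 * (2 * m + 1)) by ring, tm_even, tm_even, tm_odd]

theorem odd_case (k : ℕ) (hk : 2 ≤ k) (ho : Odd k) :
    ∃ n, gseq (k * n) = gseq (k * (n + 1)) := by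
  obtain ⟨z, hz, ht⟩ := exists_y k hk ho
  set r := 4 * z + k with hr
  have hlt : r < 2 ^ r := Nat.lt_two_pow_self
  -- choose x with 2^r * 8 x + 4 z ≡ 1 mod k
  have hcop : Nat.Coprime (2 ^ (r + 3)) k :=
    Nat.Coprime.pow_left _ (Nat.coprime_two_left.2 ho)
  obtain ⟨x, hx⟩ : ∃ x n, 2 ^ (r + 3) * x + 4 * z = k * n + 1 := by
    obtain ⟨b, hb⟩ := Nat.exists_mul_mod_eq_one_of_coprime hcop (by omega)
    obtain ⟨a, ha⟩ : ∃ a, 2 ^ (r + 3) * b = k * a + 1 :=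
      ⟨2 ^ (r + 3) * b / k, by have := Nat.div_add_mod (2 ^ (r + 3) * b) k; omega⟩
    refine ⟨b * (1 + 4 * z * (k - 1)), a * (1 + 4 * z * (k - 1)) + 4 * z, ?_⟩
    obtain ⟨j, rfl⟩ : ∃ j, k = j + 1 := ⟨k - 1, by omega⟩
    rw [← mul_assoc, ha]
    simp only [Nat.add_sub_cancel]
    ring
  obtain ⟨n, hn⟩ := hx
  have hpow : 2 ^ (r + 3) = 8 * 2 ^ r := by ring
  have hzo := hz
  obtain ⟨m, hm⟩ := hz
  have t1 := tm_add (r + 3) x (4 * z) (by omega)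
  have t2 := tm_add (r + 3) x (4 * z + k) (by omega)
  refine ⟨n, ?_⟩
  have e1 : tm (k * n + 1) = tm (k * (n + 1) + 1) := by
    rw [show k * (n + 1) + 1 = 2 ^ (r + 3) * x + (4 * z + k) by rw [mul_add]; omega, ← hn, t1, t2, ht]
  have hM : k * n + 1 = 4 * (2 * 2 ^ r * x + z) := by rw [← hn, hpow]; ring
  have hodd : Odd (2 * 2 ^ r * x + z) := by
    rw [mul_assoc]; exact Even.add_odd (even_two_mul _) hzo
  rw [g_of_four _ _ hodd hM, g_of_odd (k * (n + 1)), e1]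
  rw [show k * (n + 1) + 1 = (k * n + 1) + k by ring, hM]
  refine Even.add_odd ⟨2 * (2 * 2 ^ r * x + z), by ring⟩ ho

/-- For every k ≥ 2, the subsequence (v_{kn}) of vtm contains a square. -/
theorem vtm_subseq_not_squarefree (k : ℕ) (hk : 2 ≤ k) :
    ∃ (n L : ℕ), 1 ≤ L ∧ ∀ j < L, vtm (k * (n + j)) = vtm (k * (n + L + j)) := by
  simp only [vtm_eq]
  rcases Nat.even_or_odd k with he | ho
  · obtain ⟨p, rfl⟩ := he
    have hg : ∀ n, gseq ((p + p) * n) = fcode (tm (p * n)) (!tm (p * n)) := fun n => by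
      rw [show (p + p) * n = 2 * (p * n) by ring, g_even]
    simp only [hg]
    by_cases h0 : tm (p * 0) = tm (p * 1)
    · exact ⟨0, 1, le_refl _, fun j hj => by
        obtain rfl : j = 0 := by omega
        simp only [Nat.add_zero, Nat.zero_add, h0]⟩
    by_cases h1 : tm (p * 1) = tm (p * 2)
    · exact ⟨1, 1, le_refl _, fun j hj => by
        obtain rfl : j = 0 := by omega
        simp only [Nat.add_zero, Nat.reduceAdd, h1]⟩
    by_cases h2 : tm (p * 2) = tm (p * 3)
    · exact ⟨2, 1, le_refl _, fun j hj => by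
        obtain rfl : j = 0 := by omega
        simp only [Nat.add_zero, Nat.reduceAdd, h2]⟩
    have a : tm (p * 0) = tm (p * 2) := by
      revert h0 h1; cases tm (p * 0) <;> cases tm (p * 1) <;> cases tm (p * 2) <;> simp
    have b : tm (p * 1) = tm (p * 3) := by
      revert h1 h2; cases tm (p * 1) <;> cases tm (p * 2) <;> cases tm (p * 3) <;> simp
    refine ⟨0, 2, by omega, fun j hj => ?_⟩
    obtain rfl | rfl : j = 0 ∨ j = 1 := by omega
    · simp only [Nat.add_zero, Nat.zero_add, a]
    · simp only [Nat.zero_add, Nat.reduceAdd, b]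
  · obtain ⟨n, hn⟩ := odd_case k hk ho
    exact ⟨n, 1, le_refl _, fun j hj => by
      obtain rfl : j = 0 := by omega
      simpa using hn⟩
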